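/- Let M', O', I', B_O, B_I be pairwise disjoint subsets of {1,…,n} whose union is {1,…,n}, and let d ∈ ℝⁿ. Suppose β̂ ∈ ℝⁿ, β̂₀ ∈ ℝ and ĝ := Q β̂ + β̂₀ y satisfy: for every i ∈ B_O, ĝ_i β̂_i = 0, ĝ_i ≥ 0 and β̂_i ≥ 0; for every i ∈ B_I, ĝ_i (d_i − β̂_i) = 0, ĝ_i ≤ 0 and β̂_i ≤ d_i; ĝ_i = 0 for all i ∈ M'; β̂_i = 0 for all i ∈ O'; β̂_i = d_i for all i ∈ I'; and yᵀ β̂ = 0. Define the updated partition M_k = M' ∪ {i ∈ B_O : β̂_i > 0 and ĝ_i = 0} ∪ {i ∈ B_I : β̂_i < d_i and ĝ_i = 0}, O_k = O' ∪ {i ∈ B_O : β̂_i = 0 and ĝ_i ≥ 0}, I_k = I' ∪ {i ∈ B_I : β̂_i = d_i and ĝ_i ≤ 0}. Then M_k ∪ O_k ∪ I_k = {1,…,n}; moreover ĝ_i = 0 for all i ∈ M_k, β̂_i = 0 for all i ∈ O_k, β̂_i = d_i for all i ∈ I_k, and if the bordered matrix M̄_k = [[0, y_{M_k}ᵀ],[y_{M_k},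 Q_{M_k,M_k}]] is invertible then [β̂₀; β̂_{M_k}] = −M̄_k⁻¹ [y_{I_k}ᵀ; Q_{M_k,I_k}] d_{I_k}. -/

import Mathlib

open Matrix BigOperators

/-- The bordered matrix `M̄ = [[0, y_Mᵀ],[y_M, Q_{M,M}]]`. -/
noncomputable def bordered {n : ℕ} (Q : Matrix (Fin n) (Fin n) ℝ) (y : Fin n → ℝ)
    (M : Finset (Fin n)) : Matrix (Unit ⊕ ↥M) (Unit ⊕ ↥M) ℝ :=
  Matrix.fromBlocks 0 (Matrix.of fun _ (j : ↥M) => y j.1)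
    (Matrix.of fun (i : ↥M) _ => y i.1)
    (Q.submatrix (fun i : ↥M => i.1) (fun j : ↥M => j.1))

/-- The vector `[y_Iᵀ d_I ; Q_{M,I} d_I] ∈ ℝ^{1+|M|}`. -/
noncomputable def rhsIVec {n : ℕ} (Q : Matrix (Fin n) (Fin n) ℝ) (y : Fin n → ℝ)
    (M I : Finset (Fin n)) (d : Fin n → ℝ) : (Unit ⊕ ↥M) → ℝ :=
  Sum.elim (fun _ => ∑ i ∈ I, y i * d i) (fun m : ↥M => ∑ i ∈ I, Q m.1 i * d i)

theorem sum_mul_eq_sum_add_sum_of_cover {ι : Type*} [Fintype ι] [DecidableEq ι]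
    {M O I : Finset ι} {b d : ι → ℝ} (hcover : M ∪ O ∪ I = Finset.univ)
    (hMO : Disjoint M O) (hMI : Disjoint M I) (hOI : Disjoint O I)
    (hO : ∀ i ∈ O, b i = 0) (hI : ∀ i ∈ I, b i = d i) (w : ι → ℝ) :
    ∑ i, w i * b i = ∑ i ∈ M, w i * b i + ∑ i ∈ I, w i * d i := by
  rw [← hcover, Finset.sum_union (Finset.disjoint_union_left.2 ⟨hMI, hOI⟩),
    Finset.sum_union hMO, Finset.sum_eq_zero (s := O) fun i hi => by rw [hO i hi, mul_zero],
    add_zero, Finset.sum_congr (s₁ := I) rfl fun i hi => by rw [hI i hi]]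

theorem bordered_mulVec_elim {n : ℕ} (Q : Matrix (Fin n) (Fin n) ℝ) (y : Fin n → ℝ)
    (M : Finset (Fin n)) (b0 : ℝ) (b : Fin n → ℝ) :
    bordered Q y M *ᵥ Sum.elim (fun _ : Unit => b0) (fun m : ↥M => b m.1) =
      Sum.elim (fun _ => ∑ i ∈ M, y i * b i)
        (fun m : ↥M => y m.1 * b0 + ∑ i ∈ M, Q m.1 i * b i) := by
  ext (_ | m)
  · simpa [bordered, Matrix.mulVec, dotProduct] using
      Finset.sum_coe_sort M fun i => y i * b i
  · simpa [bordered, Matrix.mulVec, dotProduct] using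
      Finset.sum_coe_sort M fun i => Q m.1 i * b i

/-- On a partition `(M, O, I)` on which the stationarity conditions hold, `(b0, b_M)` solves
the bordered linear system. -/
theorem bordered_mulVec_eq_neg_rhsIVec {n : ℕ} {Q : Matrix (Fin n) (Fin n) ℝ}
    {y d b : Fin n → ℝ} {b0 : ℝ} {M O I : Finset (Fin n)}
    (hcover : M ∪ O ∪ I = Finset.univ)
    (hMO : Disjoint M O) (hMI : Disjoint M I) (hOI : Disjoint O I)
    (hM : ∀ i ∈ M, (Q *ᵥ b + b0 • y) i = 0)
    (hO : ∀ i ∈ O, b i = 0) (hI : ∀ i ∈ I, b i = d i) (hy : y ⬝ᵥ b = 0) :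
    bordered Q y M *ᵥ Sum.elim (fun _ : Unit => b0) (fun m : ↥M => b m.1) =
      -rhsIVec Q y M I d := by
  have key := sum_mul_eq_sum_add_sum_of_cover hcover hMO hMI hOI hO hI
  rw [bordered_mulVec_elim]
  ext (_ | m)
  · have h := key y
    simp only [dotProduct] at hy
    simp only [rhsIVec, Sum.elim_inl, Pi.neg_apply]
    linarith
  · have h := key (Q m.1)
    have hm := hM m.1 m.2
    simp only [Pi.add_apply, Matrix.mulVec, dotProduct, Pi.smul_apply, smul_eq_mul] at hm
    simp only [rhsIVec, Sum.elim_inr, Pi.neg_apply]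
    linarith

/-- Lemma 1: if `(β̂₀, β̂, ĝ)` satisfies the complementarity-type conditions on
`B_O`, `B_I` and the fixing conditions on `M'`, `O'`, `I'`, then the updated partition
`(M_k, O_k, I_k)` covers all indices, `ĝ` vanishes on `M_k`, `β̂` is `0` on `O_k`
and `d` on `I_k`, and `(β̂₀, β̂_{M_k})` solves the bordered linear system. -/
theorem updated_partition_solution
    (n : ℕ) (hn : 0 < n)
    (Q : Matrix (Fin n) (Fin n) ℝ) (hQ : Q.IsSymm)
    (y d : Fin n → ℝ)
    (M' O' I' BO BI : Finset (Fin n))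
    (h1 : Disjoint M' O') (h2 : Disjoint M' I') (h3 : Disjoint M' BO) (h4 : Disjoint M' BI)
    (h5 : Disjoint O' I') (h6 : Disjoint O' BO) (h7 : Disjoint O' BI)
    (h8 : Disjoint I' BO) (h9 : Disjoint I' BI) (h10 : Disjoint BO BI)
    (hcover : M' ∪ O' ∪ I' ∪ BO ∪ BI = Finset.univ)
    (b0 : ℝ) (b g : Fin n → ℝ)
    (hg : g = Q *ᵥ b + b0 • y)
    (hBO : ∀ i ∈ BO, g i * b i = 0 ∧ 0 ≤ g i ∧ 0 ≤ b i)
    (hBI : ∀ i ∈ BI, g i * (d i - b i) = 0 ∧ g i ≤ 0 ∧ b i ≤ d i)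
    (hM' : ∀ i ∈ M', g i = 0)
    (hO' : ∀ i ∈ O', b i = 0)
    (hI' : ∀ i ∈ I', b i = d i)
    (heq : y ⬝ᵥ b = 0)
    (Mk Ok Ik : Finset (Fin n))
    (hMk : Mk = M' ∪ BO.filter (fun i => 0 < b i ∧ g i = 0)
                  ∪ BI.filter (fun i => b i < d i ∧ g i = 0))
    (hOk : Ok = O' ∪ BO.filter (fun i => b i = 0 ∧ 0 ≤ g i))
    (hIk : Ik = I' ∪ BI.filter (fun i => b i = d i ∧ g i ≤ 0)) :
    Mk ∪ Ok ∪ Ik = Finset.univ ∧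
    (∀ i ∈ Mk, g i = 0) ∧
    (∀ i ∈ Ok, b i = 0) ∧
    (∀ i ∈ Ik, b i = d i) ∧
    (IsUnit (bordered Q y Mk) →
      Sum.elim (fun _ : Unit => b0) (fun m : ↥Mk => b m.1)
        = -((bordered Q y Mk)⁻¹ *ᵥ rhsIVec Q y Mk Ik d)) := by
  have hM : ∀ i ∈ Mk, g i = 0 := by
    simp only [hMk, Finset.mem_union, Finset.mem_filter]
    rintro i ((hi | hi) | hi)
    exacts [hM' i hi, hi.2.2, hi.2.2]
  have hO : ∀ i ∈ Ok, b i = 0 := by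
    simp only [hOk, Finset.mem_union, Finset.mem_filter]
    rintro i (hi | hi)
    exacts [hO' i hi, hi.2.1]
  have hI : ∀ i ∈ Ik, b i = d i := by
    simp only [hIk, Finset.mem_union, Finset.mem_filter]
    rintro i (hi | hi)
    exacts [hI' i hi, hi.2.1]
  have hcov : Mk ∪ Ok ∪ Ik = Finset.univ := by
    refine Finset.eq_univ_of_forall fun i => ?_
    have hi : i ∈ M' ∪ O' ∪ I' ∪ BO ∪ BI := hcover ▸ Finset.mem_univ i
    simp only [hMk, hOk, hIk, Finset.mem_union, Finset.mem_filter] at hi ⊢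
    rcases hi with (((hi | hi) | hi) | hi) | hi
    · simp [hi]
    · simp [hi]
    · simp [hi]
    · obtain ⟨hgb, hg0, hb0⟩ := hBO i hi
      rcases hb0.eq_or_lt with hb | hb
      · simp [hi, ← hb, hg0]
      · simp [hi, hb, (mul_eq_zero.1 hgb).resolve_right hb.ne']
    · obtain ⟨hgb, hg0, hbd⟩ := hBI i hi
      rcases hbd.eq_or_lt with hb | hb
      · simp [hi, hb, hg0]
      · simp [hi, hb, (mul_eq_zero.1 hgb).resolve_right (sub_pos.2 hb).ne']
  refine ⟨hcov, hM, hO, hI, fun hU => ?_⟩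
  rw [Finset.disjoint_left] at h1 h2 h3 h4 h5 h6 h7 h8 h9 h10
  have hMO : Disjoint Mk Ok := by
    rw [Finset.disjoint_left]
    simp only [hMk, hOk, Finset.mem_union, Finset.mem_filter]
    grind
  have hMI : Disjoint Mk Ik := by
    rw [Finset.disjoint_left]
    simp only [hMk, hIk, Finset.mem_union, Finset.mem_filter]
    grind
  have hOI : Disjoint Ok Ik := by
    rw [Finset.disjoint_left]
    simp only [hOk, hIk, Finset.mem_union, Finset.mem_filter]
    grind
  have hsys := bordered_mulVec_eq_neg_rhsIVec hcov hMO hMI hOI (hg ▸ hM) hO hI heq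
  rw [← Matrix.mulVec_neg, ← hsys, Matrix.mulVec_mulVec,
    Matrix.nonsing_inv_mul _ ((Matrix.isUnit_iff_isUnit_det _).1 hU), Matrix.one_mulVec]
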